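/- Let A be a real m×n matrix such that any K+1 columns of A are linearly independent (spark(A) > K+1), let 0 < γ_min ≤ γ_max, and let γ₁, γ₂ ∈ Θ_K with supp(γ₁) ≠ supp(γ₂). For σ² > 0 write Σ_{γ_i}(σ²) := σ² I_m + A diag(γ_i) A^T and define D_{1/2}(σ²) := log det( (Σ_{γ₁}(σ²) + Σ_{γ₂}(σ²))/2 ) − (1/2) log( det Σ_{γ₁}(σ²) · det Σ_{γ₂}(σ²) ), the 1/2-Rényi divergence between N(0,Σ_{γ₁}(σ²)) and N(0,Σ_{γ₂}(σ²)). Then D_{1/2}(σ²) → ∞ as σ² → 0⁺; in particular, for every fixed L ≥ 1, exp( −L·D_{1/2}(σ²)/4 ) → 0 as σ² → 0⁺. -/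

import Mathlib

open Matrix BigOperators Filter

open Classical in
/-- Support of a vector, as a finset. -/
noncomputable def suppF {ι : Type*} [Fintype ι] (x : ι → ℝ) : Finset ι :=
  Finset.univ.filter (fun i => x i ≠ 0)

/-- `γ ∈ Θ_K`: `γ` has at most `K` nonzero entries, all lying in `[γmin, γmax]`. -/
def InThetaK {n : ℕ} (γ : Fin n → ℝ) (K : ℕ) (γmin γmax : ℝ) : Prop :=
  (suppF γ).card ≤ K ∧ ∀ i, γ i ≠ 0 → γmin ≤ γ i ∧ γ i ≤ γmax

/-- `Σ_γ = σ² I_m + A diag(γ) Aᵀ`. -/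
noncomputable def SigMat {m n : ℕ} (A : Matrix (Fin m) (Fin n) ℝ) (σ2 : ℝ)
    (γ : Fin n → ℝ) : Matrix (Fin m) (Fin m) ℝ :=
  σ2 • (1 : Matrix (Fin m) (Fin m) ℝ) + A * Matrix.diagonal γ * Aᵀ

/-- The `1/2`-Rényi divergence between `N(0,Σ_{γ₁}(σ²))` and `N(0,Σ_{γ₂}(σ²))`. -/
noncomputable def renyiHalf {m n : ℕ} (A : Matrix (Fin m) (Fin n) ℝ)
    (γ1 γ2 : Fin n → ℝ) (s : ℝ) : ℝ :=
  Real.log (((2 : ℝ)⁻¹ • (SigMat A s γ1 + SigMat A s γ2)).det) -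
    (1 / 2) * Real.log ((SigMat A s γ1).det * (SigMat A s γ2).det)

/-- The determinant of `s I + M` in terms of the eigenvalues of the symmetric matrix `M`. -/
lemma Matrix.IsHermitian.det_smul_one_add {ι : Type*} [Fintype ι] [DecidableEq ι]
    {M : Matrix ι ι ℝ} (hM : M.IsHermitian) (s : ℝ) :
    (s • (1 : Matrix ι ι ℝ) + M).det = ∏ i, (s + hM.eigenvalues i) := by
  have h := Matrix.eval_charpoly M (-s)
  have h2 : Matrix.scalar ι (-s) - M = -(s • (1 : Matrix ι ι ℝ) + M) := by
    ext i j
    by_cases hij : i = j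
    · simp [hij]
      ring
    · simp [hij]
  have h3 : ∀ i, -s - hM.eigenvalues i = -1 * (s + hM.eigenvalues i) := fun i => by ring
  rw [hM.charpoly_eq, h2, Matrix.det_neg, Polynomial.eval_prod] at h
  simp only [Polynomial.eval_sub, Polynomial.eval_X, Polynomial.eval_C, RCLike.ofReal_real_eq_id,
    id_eq, h3, Finset.prod_mul_distrib, Finset.prod_const, Finset.card_univ] at h
  exact (mul_left_cancel₀ (pow_ne_zero _ (by norm_num)) h).symm

/-- For positive semidefinite `M`, `det (s I + M)` is positive when `s > 0`. -/
lemma Matrix.PosSemidef.det_smul_one_add_pos {ι : Type*} [Fintype ι] [DecidableEq ι]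
    {M : Matrix ι ι ℝ} (hM : M.PosSemidef) {s : ℝ} (hs : 0 < s) :
    0 < (s • (1 : Matrix ι ι ℝ) + M).det := by
  rw [hM.isHermitian.det_smul_one_add]
  exact Finset.prod_pos fun i _ => add_pos_of_pos_of_nonneg hs (hM.eigenvalues_nonneg i)

/-- For positive semidefinite `M`, `log det (s I + M)` behaves like `(dim - rank M) log s`
as `s → 0⁺`, up to a convergent term. -/
lemma Matrix.PosSemidef.exists_tendsto_log_det {ι : Type*} [Fintype ι] [DecidableEq ι]
    {M : Matrix ι ι ℝ} (hM : M.PosSemidef) :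
    ∃ c : ℝ, Tendsto
      (fun s : ℝ => Real.log (s • (1 : Matrix ι ι ℝ) + M).det -
        ((Fintype.card ι : ℝ) - M.rank) * Real.log s)
      (nhdsWithin 0 (Set.Ioi 0)) (nhds c) := by
  set ev := hM.isHermitian.eigenvalues with hev
  have hcard : (Fintype.card ι : ℝ) - M.rank = ∑ i, if ev i = 0 then (1 : ℝ) else 0 := by
    rw [hM.isHermitian.rank_eq_card_non_zero_eigs, Fintype.card_subtype, ← Finset.card_univ,
      ← Finset.card_filter_add_card_filter_not (s := Finset.univ) (fun i => ev i = 0)]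
    simp [hev]
  have hterm : ∀ i, ∃ c : ℝ, Tendsto
      (fun s : ℝ => Real.log (s + ev i) - (if ev i = 0 then (1 : ℝ) else 0) * Real.log s)
      (nhdsWithin 0 (Set.Ioi 0)) (nhds c) := by
    intro i
    by_cases hi : ev i = 0
    · exact ⟨0, by simp [hi]⟩
    · refine ⟨Real.log (0 + ev i), ?_⟩
      simp only [hi, if_false, zero_mul, sub_zero]
      have hc : ContinuousAt (fun s : ℝ => Real.log (s + ev i)) 0 :=
        (continuousAt_id.add continuousAt_const).log (by simpa using hi)
      exact hc.tendsto.mono_left nhdsWithin_le_nhds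
  choose c hc using hterm
  refine ⟨∑ i, c i, (tendsto_finsetSum Finset.univ fun i _ => hc i).congr' ?_⟩
  filter_upwards [self_mem_nhdsWithin] with s hs
  have hpos : ∀ i, s + ev i ≠ 0 := fun i =>
    (add_pos_of_pos_of_nonneg hs (hM.eigenvalues_nonneg i)).ne'
  rw [hM.isHermitian.det_smul_one_add, Real.log_prod fun i _ => hpos i, hcard,
    Finset.sum_sub_distrib, Finset.sum_mul]

lemma posSemidef_mul_diagonal_mul_transpose {ι κ : Type*} [Fintype ι] [Fintype κ] [DecidableEq κ]
    (A : Matrix ι κ ℝ) {d : κ → ℝ} (hd : ∀ i, 0 ≤ d i) :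
    (A * Matrix.diagonal d * Aᵀ).PosSemidef := by
  have h := (Matrix.PosSemidef.diagonal (n := κ) (d := d) hd).mul_mul_conjTranspose_same A
  rwa [Matrix.conjTranspose_eq_transpose_of_trivial] at h

lemma rank_mul_diagonal_mul_transpose_le {ι κ : Type*} [Fintype ι] [Fintype κ] [DecidableEq κ]
    (A : Matrix ι κ ℝ) (d : κ → ℝ) :
    (A * Matrix.diagonal d * Aᵀ).rank ≤ (suppF d).card := by
  classical
  calc (A * Matrix.diagonal d * Aᵀ).rank ≤ (A * Matrix.diagonal d).rank :=
        Matrix.rank_mul_le_left _ _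
    _ ≤ (Matrix.diagonal d).rank := Matrix.rank_mul_le_right _ _
    _ = (suppF d).card := by
        rw [Matrix.rank_diagonal, Fintype.card_subtype, suppF]

/-- Independent columns carrying positive weights bound the rank of `A diag(d) Aᵀ` from below. -/
lemma card_le_rank_mul_diagonal_mul_transpose {ι κ : Type*} [Fintype ι] [Fintype κ]
    [DecidableEq κ] (A : Matrix ι κ ℝ) {d : κ → ℝ} (hd : ∀ i, 0 ≤ d i) (T : Finset κ)
    (hT : ∀ i ∈ T, 0 < d i) (hli : LinearIndependent ℝ (fun j : {x // x ∈ T} => Aᵀ j.1)) :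
    T.card ≤ (A * Matrix.diagonal d * Aᵀ).rank := by
  set B := A * Matrix.diagonal (fun i => √(d i)) with hB
  have hBB : A * Matrix.diagonal d * Aᵀ = B * Bᵀ := by
    rw [hB, Matrix.transpose_mul, Matrix.diagonal_transpose, ← Matrix.mul_assoc,
      Matrix.mul_assoc A (Matrix.diagonal _) (Matrix.diagonal _), Matrix.diagonal_mul_diagonal]
    simp only [Real.mul_self_sqrt (hd _)]
  have hBli : LinearIndependent ℝ (Bᵀ.submatrix (fun j : {x // x ∈ T} => j.1) id).row := by
    convert hli.units_smul (fun j => Units.mk0 √(d j.1) (Real.sqrt_pos.2 (hT _ j.2)).ne') using 1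
    ext j i
    simp [hB, Matrix.row, Units.smul_def, mul_comm]
  rw [hBB, Matrix.rank_self_mul_transpose, ← Matrix.rank_transpose]
  calc T.card = (Bᵀ.submatrix (fun j : {x // x ∈ T} => j.1) id).rank := by
        rw [hBli.rank_matrix, Fintype.card_coe]
    _ ≤ Bᵀ.rank := Matrix.rank_submatrix_le _ _ _

lemma InThetaK.nonneg {n K : ℕ} {γ : Fin n → ℝ} {γmin γmax : ℝ} (h : InThetaK γ K γmin γmax)
    (h0 : 0 < γmin) (i : Fin n) : 0 ≤ γ i := by
  by_cases hi : γ i = 0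
  · exact hi.ge
  · exact h0.le.trans (h.2 i hi).1

/-- If `S ⊈ T`, both of size at most `K`, and `r` bounds the size of every subset of `S ∪ T` of
size at most `K + 1`, then `r` exceeds the average of the sizes of `S` and `T`. -/
lemma card_add_card_lt_two_mul {α : Type*} [DecidableEq α] {S T : Finset α} {K r : ℕ}
    (hS : S.card ≤ K) (hT : T.card ≤ K) (hST : ¬ S ⊆ T)
    (hr : ∀ U ⊆ S ∪ T, U.card ≤ K + 1 → U.card ≤ r) : S.card + T.card < 2 * r := by
  obtain ⟨i, hiS, hiT⟩ := Finset.not_subset.1 hST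
  have h1 := hr S Finset.subset_union_left (by omega)
  have h2 := hr (insert i T)
    (Finset.insert_subset (Finset.mem_union_left _ hiS) Finset.subset_union_right)
  rw [Finset.card_insert_of_notMem hiT] at h2
  have := h2 (by omega)
  omega

/-- If every `K+1` columns of `A` are linearly independent and `γ₁, γ₂ ∈ Θ_K` have
different supports, then the `1/2`-Rényi divergence between `N(0,Σ_{γ₁}(σ²))` and
`N(0,Σ_{γ₂}(σ²))` tends to `∞` as `σ² → 0⁺`; in particular, for every fixed `L ≥ 1`,
`exp(−L·D_{1/2}(σ²)/4) → 0` as `σ² → 0⁺`. -/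
theorem stmt19 {m n : ℕ} (A : Matrix (Fin m) (Fin n) ℝ) (K : ℕ)
    (hspark : ∀ S : Finset (Fin n), S.card ≤ K + 1 →
      LinearIndependent ℝ (fun j : {x // x ∈ S} => Aᵀ j.1))
    (γmin γmax : ℝ) (h0 : 0 < γmin) (h1 : γmin ≤ γmax)
    (γ1 γ2 : Fin n → ℝ)
    (hγ1 : InThetaK γ1 K γmin γmax) (hγ2 : InThetaK γ2 K γmin γmax)
    (hne : suppF γ1 ≠ suppF γ2) :
    Tendsto (renyiHalf A γ1 γ2) (nhdsWithin 0 (Set.Ioi 0)) atTop ∧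
      ∀ L : ℝ, 1 ≤ L →
        Tendsto (fun s : ℝ => Real.exp (-(L * renyiHalf A γ1 γ2 s / 4)))
          (nhdsWithin 0 (Set.Ioi 0)) (nhds 0) := by
  have hn1 := hγ1.nonneg h0
  have hn2 := hγ2.nonneg h0
  set δ : Fin n → ℝ := fun i => (γ1 i + γ2 i) / 2 with hδ
  have hnδ : ∀ i, 0 ≤ δ i := fun i => by
    have := hn1 i
    have := hn2 i
    simp only [hδ]
    linarith
  have hmid : ∀ s, (2 : ℝ)⁻¹ • (SigMat A s γ1 + SigMat A s γ2) = SigMat A s δ := by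
    intro s
    have hd : Matrix.diagonal δ = (2 : ℝ)⁻¹ • (Matrix.diagonal γ1 + Matrix.diagonal γ2) := by
      rw [Matrix.diagonal_add, ← Matrix.diagonal_smul]
      congr 1
      ext i
      simp [hδ]
      ring
    simp only [SigMat, hd, Matrix.mul_smul, Matrix.smul_mul, Matrix.mul_add, Matrix.add_mul]
    module
  have hrank : (A * Matrix.diagonal γ1 * Aᵀ).rank + (A * Matrix.diagonal γ2 * Aᵀ).rank <
      2 * (A * Matrix.diagonal δ * Aᵀ).rank := by
    have hsub : ∀ U ⊆ suppF γ1 ∪ suppF γ2, U.card ≤ K + 1 →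
        U.card ≤ (A * Matrix.diagonal δ * Aᵀ).rank := by
      intro U hU hcard
      refine card_le_rank_mul_diagonal_mul_transpose A hnδ U (fun i hi => ?_) (hspark U hcard)
      have hi' := hU hi
      simp only [suppF, Finset.mem_union, Finset.mem_filter, Finset.mem_univ, true_and] at hi'
      simp only [hδ]
      rcases hi' with hi' | hi'
      · linarith [(hn1 i).lt_of_ne' hi', hn2 i]
      · linarith [hn1 i, (hn2 i).lt_of_ne' hi']
    refine (add_le_add (rank_mul_diagonal_mul_transpose_le A γ1)
      (rank_mul_diagonal_mul_transpose_le A γ2)).trans_lt ?_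
    by_cases h : suppF γ1 ⊆ suppF γ2
    · rw [add_comm]
      exact card_add_card_lt_two_mul hγ2.1 hγ1.1 (fun h' => hne (h.antisymm h'))
        (by rwa [Finset.union_comm])
    · exact card_add_card_lt_two_mul hγ1.1 hγ2.1 h hsub
  have hp1 := posSemidef_mul_diagonal_mul_transpose A hn1
  have hp2 := posSemidef_mul_diagonal_mul_transpose A hn2
  obtain ⟨c, hc⟩ := (posSemidef_mul_diagonal_mul_transpose A hnδ).exists_tendsto_log_det
  obtain ⟨c1, hc1⟩ := hp1.exists_tendsto_log_det
  obtain ⟨c2, hc2⟩ := hp2.exists_tendsto_log_det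
  have hcoef : 0 < ((A * Matrix.diagonal δ * Aᵀ).rank : ℝ) -
      (((A * Matrix.diagonal γ1 * Aᵀ).rank : ℝ) + (A * Matrix.diagonal γ2 * Aᵀ).rank) / 2 := by
    have : (((A * Matrix.diagonal γ1 * Aᵀ).rank : ℝ) + (A * Matrix.diagonal γ2 * Aᵀ).rank) <
        2 * (A * Matrix.diagonal δ * Aᵀ).rank := by exact_mod_cast hrank
    linarith
  have hmain : Tendsto (renyiHalf A γ1 γ2) (nhdsWithin 0 (Set.Ioi 0)) atTop := by
    have hlog : Tendsto (fun s : ℝ => -Real.log s) (nhdsWithin 0 (Set.Ioi 0)) atTop :=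
      tendsto_neg_atBot_atTop.comp Real.tendsto_log_nhdsGT_zero
    refine ((hc.sub ((hc1.add hc2).const_mul (1 / 2))).add_atTop
      (hlog.const_mul_atTop hcoef)).congr' ?_
    filter_upwards [self_mem_nhdsWithin] with s hs
    rw [renyiHalf, hmid, SigMat, SigMat, SigMat,
      Real.log_mul (hp1.det_smul_one_add_pos hs).ne' (hp2.det_smul_one_add_pos hs).ne']
    ring
  refine ⟨hmain, fun L hL => Real.tendsto_exp_neg_atTop_nhds_zero.comp ?_⟩
  exact (hmain.const_mul_atTop (by linarith)).atTop_div_const (by norm_num)
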